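/- Let s_0 < s, 0 < q < ∞, 0 < r < ∞ and b < 0. Define K(t, x) as the K-functional of the couple (ℓ^{s_0}_q, ℓ^{s}_q). Then there exist constants c, C > 0, independent of the sequence x, such that c · ‖x‖_T ≤ (Σ_{j=0}^∞ [2^{j(s−s_0)} (1+j)^{b−1/r} K(2^{−j(s−s_0)}, x)]^r)^{1/r} ≤ C · ‖x‖_T, where ‖x‖_T = (Σ_{j=0}^∞ 2^{jbr} (Σ_{ν=2^j−1}^{2^{j+1}−2} (2^{νs}|x_ν|)^q)^{r/q})^{1/r}. -/

import Mathlib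

open scoped ENNReal

/-- Quasi-norm of the weighted sequence space `ℓ^σ_q`. -/
noncomputable def seqNorm (σ q : ℝ) (x : ℕ → ℝ) : ℝ≥0∞ :=
  (∑' ν : ℕ, ENNReal.ofReal (((2 : ℝ) ^ ((ν : ℝ) * σ) * |x ν|) ^ q)) ^ (1 / q)

/-- Peetre K-functional of the couple `(ℓ^{σ₀}_q, ℓ^{σ₁}_q)`
(first norm with weight `σ₀`, second with weight `σ₁`). -/
noncomputable def seqK (σ₀ σ₁ q t : ℝ) (x : ℕ → ℝ) : ℝ≥0∞ :=
  ⨅ d : {yz : (ℕ → ℝ) × (ℕ → ℝ) // ∀ ν, x ν = yz.1 ν + yz.2 ν},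
    seqNorm σ₀ q d.val.1 + ENNReal.ofReal t * seqNorm σ₁ q d.val.2

lemma two_rpow_add (s t : ℝ) : (2 : ℝ≥0∞) ^ (s + t) = 2 ^ s * 2 ^ t :=
  ENNReal.rpow_add s t two_ne_zero ENNReal.ofNat_ne_top

lemma two_rpow_mono {s t : ℝ} (h : s ≤ t) : (2 : ℝ≥0∞) ^ s ≤ 2 ^ t :=
  ENNReal.rpow_le_rpow_of_exponent_le one_le_two h

lemma two_rpow_ne_top (t : ℝ) : (2 : ℝ≥0∞) ^ t ≠ ∞ :=
  ENNReal.rpow_ne_top_of_ne_zero two_ne_zero ENNReal.ofNat_ne_top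

lemma two_rpow_pos (t : ℝ) : 0 < (2 : ℝ≥0∞) ^ t :=
  ENNReal.rpow_pos (by norm_num) ENNReal.ofNat_ne_top

lemma ofReal_two_rpow (t : ℝ) : ENNReal.ofReal ((2 : ℝ) ^ t) = (2 : ℝ≥0∞) ^ t := by
  rw [← ENNReal.ofReal_rpow_of_pos two_pos]
  simp

/-- Schur-type bound for a kernel of the form `u ^ 2`, valid for every exponent `p > 0`. -/
lemma tsum_tsum_mul_rpow_le {p : ℝ} (hp : 0 < p) (u : ℕ → ℕ → ℝ≥0∞) (B : ℕ → ℝ≥0∞)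
    {M N : ℝ≥0∞} (hM : ∀ k, ∑' i, u k i ≤ M) (hN : ∀ i, ∑' k, u k i ^ p ≤ N) :
    ∑' k, (∑' i, u k i * u k i * B i) ^ p ≤ M ^ p * N * ∑' i, B i ^ p := by
  have key : ∀ k, (∑' i, u k i * u k i * B i) ^ p ≤ M ^ p * ∑' i, u k i ^ p * B i ^ p := by
    intro k
    have hS : ∀ i, u k i * B i ≤ (∑' i, u k i ^ p * B i ^ p) ^ (1 / p) := by
      intro i
      rw [one_div, ENNReal.le_rpow_inv_iff hp, ENNReal.mul_rpow_of_nonneg _ _ hp.le]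
      exact ENNReal.le_tsum i
    calc (∑' i, u k i * u k i * B i) ^ p
        ≤ (M * (∑' i, u k i ^ p * B i ^ p) ^ (1 / p)) ^ p := by
          refine ENNReal.rpow_le_rpow ?_ hp.le
          calc ∑' i, u k i * u k i * B i
              ≤ ∑' i, u k i * (∑' i, u k i ^ p * B i ^ p) ^ (1 / p) := by
                refine ENNReal.tsum_le_tsum fun i => ?_
                rw [mul_assoc]
                gcongr
                exact hS i
            _ ≤ _ := by
                rw [ENNReal.tsum_mul_right]
                gcongr
                exact hM k
      _ = _ := by
          rw [ENNReal.mul_rpow_of_nonneg _ _ hp.le, ← ENNReal.rpow_mul, one_div,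
            inv_mul_cancel₀ hp.ne', ENNReal.rpow_one]
  calc ∑' k, (∑' i, u k i * u k i * B i) ^ p
      ≤ ∑' k, M ^ p * ∑' i, u k i ^ p * B i ^ p := ENNReal.tsum_le_tsum key
    _ = M ^ p * ∑' i, (∑' k, u k i ^ p) * B i ^ p := by
        rw [ENNReal.tsum_mul_left, ENNReal.tsum_comm]
        simp_rw [ENNReal.tsum_mul_right]
    _ ≤ M ^ p * ∑' i, N * B i ^ p := by
        gcongr with i
        exact hN i
    _ = _ := by rw [ENNReal.tsum_mul_left, mul_assoc]

lemma exists_tsum_two_rpow_abs_le {γ : ℝ} (hγ : 0 < γ) :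
    ∃ M : ℝ≥0∞, M ≠ ∞ ∧ ∀ k : ℕ, ∑' i : ℕ, (2 : ℝ≥0∞) ^ (-γ * |(i : ℝ) - k|) ≤ M := by
  set ρ : ℝ≥0∞ := 2 ^ (-γ) with hρ
  have hρ1 : ρ < 1 := ENNReal.rpow_lt_one_of_one_lt_of_neg (by norm_num) (by linarith)
  have hpow : ∀ n : ℕ, (2 : ℝ≥0∞) ^ (-γ * (n : ℝ)) = ρ ^ n := fun n => by
    rw [ENNReal.rpow_mul, ENNReal.rpow_natCast]
  refine ⟨∑' n : ℕ, ρ ^ n + ∑' n : ℕ, ρ ^ n, ?_, fun k => ?_⟩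
  · rw [ENNReal.tsum_geometric]
    have : (1 - ρ)⁻¹ ≠ ∞ := by
      rw [ENNReal.inv_ne_top]
      exact (tsub_pos_of_lt hρ1).ne'
    exact ENNReal.add_ne_top.2 ⟨this, this⟩
  · rw [← ENNReal.summable.sum_add_tsum_nat_add' (k := k)]
    refine add_le_add ?_ ?_
    · rw [← Finset.sum_range_reflect]
      refine le_trans (Finset.sum_le_sum fun i hi => ?_) (ENNReal.sum_le_tsum (Finset.range k))
      have hi' : i < k := Finset.mem_range.1 hi
      rw [← hpow]
      refine two_rpow_mono (mul_le_mul_of_nonpos_left ?_ (by linarith))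
      have : ((k - 1 - i : ℕ) : ℝ) + 1 + i = k := by
        exact_mod_cast (by omega : k - 1 - i + 1 + i = k)
      rw [abs_sub_comm]
      exact le_trans (by linarith) (le_abs_self _)
    · refine ENNReal.tsum_le_tsum fun i => le_of_eq ?_
      rw [← hpow]
      simp

lemma mem_block_iff (k ν : ℕ) :
    ν ∈ Finset.Icc (2 ^ k - 1 : ℕ) (2 ^ (k + 1) - 2) ↔ 2 ^ k ≤ ν + 1 ∧ ν + 1 < 2 ^ (k + 1) := by
  have : 1 ≤ 2 ^ k := Nat.one_le_two_pow
  rw [Finset.mem_Icc, pow_succ]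
  omega

lemma card_block (k : ℕ) : (Finset.Icc (2 ^ k - 1 : ℕ) (2 ^ (k + 1) - 2)).card = 2 ^ k := by
  have : 1 ≤ 2 ^ k := Nat.one_le_two_pow
  rw [Nat.card_Icc, pow_succ]
  omega

lemma tsum_eq_tsum_sum_block (f : ℕ → ℝ≥0∞) :
    ∑' ν, f ν = ∑' k : ℕ, ∑ ν ∈ Finset.Icc (2 ^ k - 1 : ℕ) (2 ^ (k + 1) - 2), f ν := by
  have h : ∀ k : ℕ, ∑ ν ∈ Finset.Icc (2 ^ k - 1 : ℕ) (2 ^ (k + 1) - 2), f ν =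
      ∑' ν, if k = Nat.log 2 (ν + 1) then f ν else 0 := by
    intro k
    have hmem : ∀ ν, ν ∈ Finset.Icc (2 ^ k - 1 : ℕ) (2 ^ (k + 1) - 2) ↔
        k = Nat.log 2 (ν + 1) := fun ν => by
      rw [mem_block_iff, eq_comm, Nat.log_eq_iff (Or.inr ⟨by norm_num, by omega⟩)]
    rw [tsum_eq_sum (s := Finset.Icc (2 ^ k - 1 : ℕ) (2 ^ (k + 1) - 2))
      (fun ν hν => if_neg (fun h => hν ((hmem ν).2 h)))]
    exact Finset.sum_congr rfl fun ν hν => (if_pos ((hmem ν).1 hν)).symm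
  simp_rw [h]
  rw [ENNReal.tsum_comm]
  exact tsum_congr fun ν => (tsum_ite_eq (Nat.log 2 (ν + 1)) fun _ => f ν).symm

lemma abs_add_rpow_le {q : ℝ} (hq : 0 < q) (y z : ℝ) :
    |y + z| ^ q ≤ 2 ^ q * (|y| ^ q + |z| ^ q) := by
  have h1 : |y + z| ≤ 2 * max |y| |z| := by
    have := abs_add_le y z
    have := le_max_left |y| |z|
    have := le_max_right |y| |z|
    linarith
  calc |y + z| ^ q ≤ (2 * max |y| |z|) ^ q := Real.rpow_le_rpow (abs_nonneg _) h1 hq.le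
    _ = 2 ^ q * (max |y| |z|) ^ q := Real.mul_rpow (by norm_num) (by positivity)
    _ ≤ _ := by
      gcongr
      have hy : 0 ≤ |y| ^ q := by positivity
      have hz : 0 ≤ |z| ^ q := by positivity
      rcases max_choice |y| |z| with h | h <;> rw [h] <;> linarith

lemma seqNorm_rpow {q : ℝ} (hq : 0 < q) (σ : ℝ) (x : ℕ → ℝ) :
    seqNorm σ q x ^ q =
      ∑' ν : ℕ, ENNReal.ofReal (((2 : ℝ) ^ ((ν : ℝ) * σ) * |x ν|) ^ q) := by
  rw [seqNorm, ← ENNReal.rpow_mul, one_div, inv_mul_cancel₀ hq.ne', ENNReal.rpow_one]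

lemma ofReal_weight {q : ℝ} (t a : ℝ) :
    ENNReal.ofReal (((2 : ℝ) ^ t * |a|) ^ q) = 2 ^ (t * q) * ENNReal.ofReal (|a| ^ q) := by
  rw [Real.mul_rpow (by positivity) (abs_nonneg _), ENNReal.ofReal_mul (by positivity),
    ← Real.rpow_mul two_pos.le, ofReal_two_rpow]

/-- Partial `ℓ^s_q` sums up to level `j` are controlled by `2^{j(s-s₀)} K(2^{-j(s-s₀)}, x)`. -/
lemma sum_le_seqK {s₀ s q : ℝ} (hs : s₀ < s) (hq : 0 < q) (x : ℕ → ℝ) (j : ℕ)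
    (S : Finset ℕ) (hS : ∀ ν ∈ S, ν ≤ j) :
    (2 : ℝ≥0∞) ^ (-(1 + 1 / q)) *
        (∑ ν ∈ S, ENNReal.ofReal (((2 : ℝ) ^ ((ν : ℝ) * s) * |x ν|) ^ q)) ^ (1 / q) ≤
      2 ^ ((j : ℝ) * (s - s₀)) * seqK s₀ s q ((2 : ℝ) ^ (-(j : ℝ) * (s - s₀))) x := by
  rw [seqK, ENNReal.mul_iInf_of_ne (two_rpow_pos _).ne' (two_rpow_ne_top _)]
  refine le_iInf fun ⟨⟨y, z⟩, hd⟩ => ?_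
  dsimp only at hd ⊢
  rw [ofReal_two_rpow, mul_add, ← mul_assoc, ← two_rpow_add,
    show (j : ℝ) * (s - s₀) + -(j : ℝ) * (s - s₀) = 0 by ring, ENNReal.rpow_zero, one_mul]
  set G := (2 : ℝ≥0∞) ^ ((j : ℝ) * (s - s₀)) * seqNorm s₀ q y + seqNorm s q z with hG
  have hY : ∑ ν ∈ S, ENNReal.ofReal (((2 : ℝ) ^ ((ν : ℝ) * s) * |y ν|) ^ q) ≤ G ^ q := by
    calc _ ≤ ∑ ν ∈ S, (2 : ℝ≥0∞) ^ ((j : ℝ) * (s - s₀) * q) *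
          ENNReal.ofReal (((2 : ℝ) ^ ((ν : ℝ) * s₀) * |y ν|) ^ q) := by
          refine Finset.sum_le_sum fun ν hν => ?_
          rw [ofReal_weight, ofReal_weight, ← mul_assoc, ← two_rpow_add]
          refine mul_le_mul_left (two_rpow_mono ?_) _
          have h1 : (ν : ℝ) ≤ j := by exact_mod_cast hS ν hν
          have h2 : (ν : ℝ) * (s - s₀) ≤ j * (s - s₀) :=
            mul_le_mul_of_nonneg_right h1 (by linarith)
          nlinarith
      _ ≤ (2 : ℝ≥0∞) ^ ((j : ℝ) * (s - s₀) * q) * seqNorm s₀ q y ^ q := by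
          rw [← Finset.mul_sum, seqNorm_rpow hq]
          gcongr
          exact ENNReal.sum_le_tsum S
      _ ≤ G ^ q := by
          rw [ENNReal.rpow_mul, ← ENNReal.mul_rpow_of_nonneg _ _ hq.le]
          exact ENNReal.rpow_le_rpow le_self_add hq.le
  have hZ : ∑ ν ∈ S, ENNReal.ofReal (((2 : ℝ) ^ ((ν : ℝ) * s) * |z ν|) ^ q) ≤ G ^ q := by
    refine (ENNReal.sum_le_tsum S).trans ?_
    rw [← seqNorm_rpow hq]
    exact ENNReal.rpow_le_rpow le_add_self hq.le
  have hX : ∑ ν ∈ S, ENNReal.ofReal (((2 : ℝ) ^ ((ν : ℝ) * s) * |x ν|) ^ q) ≤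
      2 ^ (q + 1) * G ^ q := by
    calc _ ≤ ∑ ν ∈ S, 2 ^ q * (ENNReal.ofReal (((2 : ℝ) ^ ((ν : ℝ) * s) * |y ν|) ^ q) +
          ENNReal.ofReal (((2 : ℝ) ^ ((ν : ℝ) * s) * |z ν|) ^ q)) := by
          refine Finset.sum_le_sum fun ν _ => ?_
          rw [ofReal_weight, ofReal_weight, ofReal_weight, ← mul_add, mul_left_comm, hd ν,
            ← ENNReal.ofReal_add (by positivity) (by positivity), ← ofReal_two_rpow q,
            ← ENNReal.ofReal_mul (by positivity)]
          gcongr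
          exact abs_add_rpow_le hq _ _
      _ ≤ 2 ^ q * (G ^ q + G ^ q) := by
          rw [← Finset.mul_sum, Finset.sum_add_distrib]
          gcongr
      _ = _ := by rw [two_rpow_add, ENNReal.rpow_one, ← two_mul, mul_assoc]
  calc _ ≤ (2 : ℝ≥0∞) ^ (-(1 + 1 / q)) * (2 ^ (q + 1) * G ^ q) ^ (1 / q) := by gcongr
    _ = G := by
      rw [ENNReal.mul_rpow_of_nonneg _ _ (by positivity), ← ENNReal.rpow_mul,
        ← ENNReal.rpow_mul, ← mul_assoc, ← two_rpow_add,
        show -(1 + 1 / q) + (q + 1) * (1 / q) = 0 by field_simp; ring,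
        mul_one_div_cancel hq.ne']
      simp

/-- Upper bound for `2^{j(s-s₀)} K(2^{-j(s-s₀)}, x)` obtained by cutting the sequence at `j`. -/
lemma seqK_le {s₀ s q : ℝ} (hq : 0 < q) (x : ℕ → ℝ) (j : ℕ) :
    2 ^ ((j : ℝ) * (s - s₀)) * seqK s₀ s q ((2 : ℝ) ^ (-(j : ℝ) * (s - s₀))) x ≤
      2 * (∑' ν : ℕ, (2 : ℝ≥0∞) ^ (-((s - s₀) * q) * max 0 ((ν : ℝ) - j)) *
        ENNReal.ofReal (((2 : ℝ) ^ ((ν : ℝ) * s) * |x ν|) ^ q)) ^ (1 / q) := by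
  set T := ∑' ν : ℕ, (2 : ℝ≥0∞) ^ (-((s - s₀) * q) * max 0 ((ν : ℝ) - j)) *
        ENNReal.ofReal (((2 : ℝ) ^ ((ν : ℝ) * s) * |x ν|) ^ q) with hT
  let y : ℕ → ℝ := fun ν => if ν ≤ j then 0 else x ν
  let z : ℕ → ℝ := fun ν => if ν ≤ j then x ν else 0
  have hd : ∀ ν, x ν = y ν + z ν := fun ν => by
    by_cases h : ν ≤ j <;> simp [y, z, h]
  have hK : seqK s₀ s q ((2 : ℝ) ^ (-(j : ℝ) * (s - s₀))) x ≤ seqNorm s₀ q y +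
      ENNReal.ofReal ((2 : ℝ) ^ (-(j : ℝ) * (s - s₀))) * seqNorm s q z :=
    iInf_le_of_le ⟨(y, z), hd⟩ le_rfl
  have hY : 2 ^ ((j : ℝ) * (s - s₀)) * seqNorm s₀ q y ≤ T ^ (1 / q) := by
    rw [one_div, ENNReal.le_rpow_inv_iff hq, ENNReal.mul_rpow_of_nonneg _ _ hq.le, seqNorm_rpow hq,
      ← ENNReal.tsum_mul_left]
    refine ENNReal.tsum_le_tsum fun ν => ?_
    by_cases h : ν ≤ j
    · simp [y, h, Real.zero_rpow hq.ne']
    · have h1 : (j : ℝ) ≤ ν := by exact_mod_cast (not_le.1 h).le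
      rw [ofReal_weight, ofReal_weight, ← mul_assoc, ← mul_assoc, ← ENNReal.rpow_mul,
        ← two_rpow_add, ← two_rpow_add, max_eq_right (by linarith)]
      simp only [y, h, if_false]
      refine le_of_eq ?_
      congr 2
      ring
  have hZ : seqNorm s q z ≤ T ^ (1 / q) := by
    rw [one_div, ENNReal.le_rpow_inv_iff hq, seqNorm_rpow hq]
    refine ENNReal.tsum_le_tsum fun ν => ?_
    by_cases h : ν ≤ j
    · have h1 : (ν : ℝ) ≤ j := by exact_mod_cast h
      rw [max_eq_left (by linarith)]
      simp [z, h]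
    · simp [z, h, Real.zero_rpow hq.ne']
  calc _ ≤ 2 ^ ((j : ℝ) * (s - s₀)) * (seqNorm s₀ q y +
      ENNReal.ofReal ((2 : ℝ) ^ (-(j : ℝ) * (s - s₀))) * seqNorm s q z) := by gcongr
    _ = 2 ^ ((j : ℝ) * (s - s₀)) * seqNorm s₀ q y + seqNorm s q z := by
      rw [ofReal_two_rpow, mul_add, ← mul_assoc, ← two_rpow_add,
        show (j : ℝ) * (s - s₀) + -(j : ℝ) * (s - s₀) = 0 by ring, ENNReal.rpow_zero, one_mul]
    _ ≤ T ^ (1 / q) + T ^ (1 / q) := add_le_add hY hZ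
    _ = _ := (two_mul _).symm

lemma sq_le_two_pow_succ (m : ℕ) : m ^ 2 ≤ 2 ^ (m + 1) := by
  induction m with
  | zero => norm_num
  | succ n ih =>
    rcases le_or_gt n 2 with h | h
    · interval_cases n <;> norm_num
    · rw [pow_succ 2 (n + 1)]
      nlinarith

/-- The gap between dyadic block indices is dominated by the gap between their elements. -/
lemma exists_block_gap_le {α β : ℝ} (hα : 0 < α) (hβ : 0 < β) :
    ∃ L : ℝ, ∀ i k ν j : ℕ, ν ∈ Finset.Icc (2 ^ i - 1 : ℕ) (2 ^ (i + 1) - 2) →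
      j ∈ Finset.Icc (2 ^ k - 1 : ℕ) (2 ^ (k + 1) - 2) →
      β * max 0 ((i : ℝ) - k) ≤ α * max 0 ((ν : ℝ) - j) + L := by
  refine ⟨β + β ^ 2 / (2 * α), fun i k ν j hν hj => ?_⟩
  rw [mem_block_iff] at hν hj
  have hL : 0 ≤ β ^ 2 / (2 * α) := by positivity
  have hpos : 0 ≤ α * max 0 ((ν : ℝ) - j) := by positivity
  rcases le_or_gt i k with h | h
  · have : (i : ℝ) ≤ k := by exact_mod_cast h
    rw [max_eq_left (by linarith)]
    linarith
  · obtain ⟨m, rfl⟩ := Nat.exists_eq_add_of_lt h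
    have hlt : 2 ^ (k + 1) * 2 ^ m ≤ ν + 1 := by
      rw [← pow_add]
      calc 2 ^ (k + 1 + m) = 2 ^ (k + m + 1) := by ring_nf
        _ ≤ _ := hν.1
    have h1 : 2 ^ m + j ≤ ν := by
      have := Nat.one_le_two_pow (n := m)
      nlinarith
    have h2 : m ^ 2 + 2 * j ≤ 2 * ν := by
      have h3 := sq_le_two_pow_succ m
      rw [pow_succ 2 m] at h3
      linarith
    have h2' : (m : ℝ) ^ 2 + 2 * j ≤ 2 * ν := by exact_mod_cast h2
    have hm : ((k + m + 1 : ℕ) : ℝ) - k = m + 1 := by push_cast; ring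
    rw [hm, max_eq_right (by positivity)]
    have h4 : α * ((m : ℝ) ^ 2 / 2) ≤ α * max 0 ((ν : ℝ) - j) :=
      mul_le_mul_of_nonneg_left (le_max_of_le_right (by linarith)) hα.le
    have h5 : α * ((m : ℝ) ^ 2 / 2) + β ^ 2 / (2 * α) - β * m = (α * m - β) ^ 2 / (2 * α) := by
      field_simp
      ring
    have h6 : 0 ≤ (α * m - β) ^ 2 / (2 * α) := by positivity
    linarith

lemma weight_le {κ : ℝ} (hκ : κ ≤ 0) {k j : ℕ}
    (hj : j ∈ Finset.Icc (2 ^ k - 1 : ℕ) (2 ^ (k + 1) - 2)) :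
    ENNReal.ofReal ((1 + (j : ℝ)) ^ κ) ≤ 2 ^ ((k : ℝ) * κ) := by
  rw [mem_block_iff] at hj
  have h : (2 : ℝ) ^ (k : ℝ) ≤ 1 + j := by
    rw [Real.rpow_natCast, add_comm]
    exact_mod_cast hj.1
  rw [← ofReal_two_rpow, Real.rpow_mul two_pos.le]
  exact ENNReal.ofReal_le_ofReal (Real.rpow_le_rpow_of_nonpos (by positivity) h hκ)

lemma le_weight {κ : ℝ} (hκ : κ ≤ 0) {k j : ℕ}
    (hj : j ∈ Finset.Icc (2 ^ k - 1 : ℕ) (2 ^ (k + 1) - 2)) :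
    2 ^ (((k : ℝ) + 1) * κ) ≤ ENNReal.ofReal ((1 + (j : ℝ)) ^ κ) := by
  rw [mem_block_iff] at hj
  have h : 1 + (j : ℝ) ≤ (2 : ℝ) ^ ((k : ℝ) + 1) := by
    rw [add_comm 1, ← Nat.cast_succ k, Real.rpow_natCast]
    exact_mod_cast hj.2.le
  rw [← ofReal_two_rpow, Real.rpow_mul two_pos.le]
  exact ENNReal.ofReal_le_ofReal (Real.rpow_le_rpow_of_nonpos (by positivity) h hκ)

lemma weight_mul_rpow {r : ℝ} (hr : 0 < r) (δ b : ℝ) (j : ℕ) (K : ℝ≥0∞) :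
    ENNReal.ofReal ((2 : ℝ) ^ ((j : ℝ) * δ * r) * (1 + (j : ℝ)) ^ ((b - 1 / r) * r)) * K ^ r =
      ENNReal.ofReal ((1 + (j : ℝ)) ^ (b * r - 1)) * (2 ^ ((j : ℝ) * δ) * K) ^ r := by
  rw [ENNReal.ofReal_mul (by positivity), ofReal_two_rpow, ENNReal.mul_rpow_of_nonneg _ _ hr.le,
    ← ENNReal.rpow_mul, show (b - 1 / r) * r = b * r - 1 by field_simp]
  ring

lemma two_pow_eq_rpow (k : ℕ) : ((2 ^ k : ℕ) : ℝ≥0∞) = 2 ^ (k : ℝ) := by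
  rw [ENNReal.rpow_natCast]
  push_cast
  rfl

/-- Lower estimate for a weighted sum of `G j` dominating all block sums before `j`. -/
lemma block_sum_le_tsum_weight {q r b : ℝ} (hr : 0 < r) (hb : b < 0) (η : ℝ)
    (A G : ℕ → ℝ≥0∞)
    (hG : ∀ k j, j ∈ Finset.Icc (2 ^ (k + 1) - 1 : ℕ) (2 ^ (k + 1 + 1) - 2) →
      2 ^ η * A k ^ (1 / q) ≤ G j) :
    2 ^ (2 * (b * r) - 1 + η * r) * ∑' k : ℕ, 2 ^ ((k : ℝ) * b * r) * A k ^ (r / q) ≤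
      ∑' j : ℕ, ENNReal.ofReal ((1 + (j : ℝ)) ^ (b * r - 1)) * G j ^ r := by
  have hκ : b * r - 1 ≤ 0 := by nlinarith
  rw [tsum_eq_tsum_sum_block fun j => ENNReal.ofReal ((1 + (j : ℝ)) ^ (b * r - 1)) * G j ^ r,
    ← ENNReal.tsum_mul_left]
  refine le_trans (ENNReal.tsum_le_tsum fun k => ?_)
    (ENNReal.tsum_comp_le_tsum_of_injective (add_left_injective 1) _)
  calc _ = ∑ j ∈ Finset.Icc (2 ^ (k + 1) - 1 : ℕ) (2 ^ (k + 1 + 1) - 2),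
        2 ^ ((((k + 1 : ℕ) : ℝ) + 1) * (b * r - 1)) * (2 ^ η * A k ^ (1 / q)) ^ r := by
        rw [Finset.sum_const, card_block, nsmul_eq_mul, two_pow_eq_rpow,
          ENNReal.mul_rpow_of_nonneg _ _ hr.le, ← ENNReal.rpow_mul, ← ENNReal.rpow_mul,
          one_div_mul_eq_div]
        simp only [← mul_assoc, ← two_rpow_add]
        congr 2
        push_cast
        ring
    _ ≤ _ := by
        refine Finset.sum_le_sum fun j hj => ?_
        exact mul_le_mul' (le_weight hκ hj) (ENNReal.rpow_le_rpow (hG k j hj) hr.le)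

/-- Upper estimate for a weighted sum of `G j`, dominated by a sum of block sums which is damped
past the block of `j`. -/
lemma exists_tsum_weight_le_block_sum {q r b : ℝ} (hq : 0 < q) (hr : 0 < r) (hb : b < 0)
    (L : ℝ) :
    ∃ C : ℝ≥0∞, C ≠ ∞ ∧ ∀ A G : ℕ → ℝ≥0∞,
      (∀ k j : ℕ, j ∈ Finset.Icc (2 ^ k - 1 : ℕ) (2 ^ (k + 1) - 2) →
        G j ≤ 2 * (∑' i : ℕ, 2 ^ (L - 2 * (-b * q) * max 0 ((i : ℝ) - k)) * A i) ^ (1 / q)) →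
      ∑' j : ℕ, ENNReal.ofReal ((1 + (j : ℝ)) ^ (b * r - 1)) * G j ^ r ≤
        C * ∑' k : ℕ, 2 ^ ((k : ℝ) * b * r) * A k ^ (r / q) := by
  have hκ : b * r - 1 ≤ 0 := by nlinarith
  have hβ : 0 < -b * q := by nlinarith
  have hp : 0 < r / q := by positivity
  obtain ⟨M, hM, hM'⟩ := exists_tsum_two_rpow_abs_le (γ := -b * q / 2) (by positivity)
  obtain ⟨N, hN, hN'⟩ := exists_tsum_two_rpow_abs_le (γ := -b * q / 2 * (r / q)) (by positivity)
  refine ⟨2 ^ (r + L * (r / q)) * (M ^ (r / q) * N), ?_, fun A G hG => ?_⟩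
  · exact ENNReal.mul_ne_top (two_rpow_ne_top _)
      (ENNReal.mul_ne_top (ENNReal.rpow_ne_top_of_nonneg hp.le hM) hN)
  let u : ℕ → ℕ → ℝ≥0∞ := fun k i => 2 ^ (-(-b * q / 2) * |(i : ℝ) - k|)
  let B : ℕ → ℝ≥0∞ := fun i => 2 ^ ((i : ℝ) * b * q) * A i
  let V : ℕ → ℝ≥0∞ := fun k => ∑' i : ℕ, 2 ^ (L - 2 * (-b * q) * max 0 ((i : ℝ) - k)) * A i
  have hschur := tsum_tsum_mul_rpow_le hp u B hM' (N := N) (fun i => by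
    refine le_trans (le_of_eq (tsum_congr fun k => ?_)) (hN' i)
    simp only [u]
    rw [← ENNReal.rpow_mul, abs_sub_comm]
    congr 1
    ring)
  have hB : ∀ i, B i ^ (r / q) = 2 ^ ((i : ℝ) * b * r) * A i ^ (r / q) := fun i => by
    simp only [B]
    rw [ENNReal.mul_rpow_of_nonneg _ _ hp.le, ← ENNReal.rpow_mul]
    congr 2
    field_simp
  have hV : ∀ k : ℕ, 2 ^ ((k : ℝ) * b * q) * V k = 2 ^ L * ∑' i, u k i * u k i * B i := by
    intro k
    simp only [V, u, B]
    rw [← ENNReal.tsum_mul_left, ← ENNReal.tsum_mul_left]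
    refine tsum_congr fun i => ?_
    simp only [← mul_assoc, ← two_rpow_add]
    congr 2
    rcases le_total (i : ℝ) k with h | h
    · rw [max_eq_left (by linarith), abs_of_nonpos (by linarith)]
      ring
    · rw [max_eq_right (by linarith), abs_of_nonneg (by linarith)]
      ring
  simp_rw [hB] at hschur
  rw [tsum_eq_tsum_sum_block fun j => ENNReal.ofReal ((1 + (j : ℝ)) ^ (b * r - 1)) * G j ^ r]
  calc _ ≤ ∑' k : ℕ, 2 ^ (r + L * (r / q)) * (∑' i, u k i * u k i * B i) ^ (r / q) := by
        refine ENNReal.tsum_le_tsum fun k => ?_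
        calc _ ≤ ∑ j ∈ Finset.Icc (2 ^ k - 1 : ℕ) (2 ^ (k + 1) - 2),
              2 ^ ((k : ℝ) * (b * r - 1)) * (2 * V k ^ (1 / q)) ^ r :=
              Finset.sum_le_sum fun j hj =>
                mul_le_mul' (weight_le hκ hj) (ENNReal.rpow_le_rpow (hG k j hj) hr.le)
          _ = 2 ^ r * (2 ^ ((k : ℝ) * b * q) * V k) ^ (r / q) := by
              rw [Finset.sum_const, card_block, nsmul_eq_mul, two_pow_eq_rpow,
                ENNReal.mul_rpow_of_nonneg _ _ hr.le, ENNReal.mul_rpow_of_nonneg _ _ hp.le,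
                ← ENNReal.rpow_mul, ← ENNReal.rpow_mul, one_div_mul_eq_div]
              simp only [← mul_assoc, ← two_rpow_add]
              congr 2
              field_simp
              ring
          _ = _ := by
              rw [hV, ENNReal.mul_rpow_of_nonneg _ _ hp.le, ← ENNReal.rpow_mul, ← mul_assoc,
                ← two_rpow_add]
    _ ≤ _ := by
        rw [ENNReal.tsum_mul_left, mul_assoc]
        gcongr

/-- For `s₀ < s`, `b < 0`: the limiting interpolation quasi-norm
`(Σ_j [2^{j(s-s₀)}(1+j)^{b-1/r} K(2^{-j(s-s₀)}, x; ℓ^{s₀}_q, ℓ^s_q)]^r)^{1/r}`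
is equivalent to the truncated quasi-norm built from the dyadic blocks
`I_j = {2^j-1, …, 2^{j+1}-2}`. -/
theorem limiting_interpolation_eq_truncated_neg (s₀ s q r b : ℝ) (hs : s₀ < s)
    (hq : 0 < q) (hr : 0 < r) (hb : b < 0) :
    ∃ c C : ℝ, 0 < c ∧ 0 < C ∧
      ∀ x : ℕ → ℝ,
        (ENNReal.ofReal c *
            (∑' j : ℕ, ENNReal.ofReal ((2 : ℝ) ^ ((j : ℝ) * b * r)) *
              (∑ ν ∈ Finset.Icc (2 ^ j - 1 : ℕ) (2 ^ (j + 1) - 2),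
                ENNReal.ofReal (((2 : ℝ) ^ ((ν : ℝ) * s) * |x ν|) ^ q)) ^ (r / q)) ^ (1 / r) ≤
          (∑' j : ℕ,
              ENNReal.ofReal
                  ((2 : ℝ) ^ ((j : ℝ) * (s - s₀) * r) * (1 + (j : ℝ)) ^ ((b - 1 / r) * r)) *
                (seqK s₀ s q ((2 : ℝ) ^ (-(j : ℝ) * (s - s₀))) x) ^ r) ^ (1 / r)) ∧
        ((∑' j : ℕ,
              ENNReal.ofReal
                  ((2 : ℝ) ^ ((j : ℝ) * (s - s₀) * r) * (1 + (j : ℝ)) ^ ((b - 1 / r) * r)) *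
                (seqK s₀ s q ((2 : ℝ) ^ (-(j : ℝ) * (s - s₀))) x) ^ r) ^ (1 / r) ≤
          ENNReal.ofReal C *
            (∑' j : ℕ, ENNReal.ofReal ((2 : ℝ) ^ ((j : ℝ) * b * r)) *
              (∑ ν ∈ Finset.Icc (2 ^ j - 1 : ℕ) (2 ^ (j + 1) - 2),
                ENNReal.ofReal (((2 : ℝ) ^ ((ν : ℝ) * s) * |x ν|) ^ q)) ^ (r / q)) ^ (1 / r)) := by
  have hα : 0 < (s - s₀) * q := mul_pos (by linarith) hq
  have hβ : 0 < 2 * (-b * q) := by nlinarith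
  obtain ⟨L, hL⟩ := exists_block_gap_le hα hβ
  obtain ⟨D, hD, hupper⟩ := exists_tsum_weight_le_block_sum hq hr hb L
  have hD' : D ^ (1 / r) ≠ ∞ := ENNReal.rpow_ne_top_of_nonneg (by positivity) hD
  refine ⟨2 ^ ((2 * (b * r) - 1 + -(1 + 1 / q) * r) * (1 / r)), (D ^ (1 / r)).toReal + 1,
    by positivity, by positivity, fun x => ?_⟩
  simp_rw [weight_mul_rpow hr, ofReal_two_rpow]
  constructor
  · rw [ENNReal.rpow_mul, ← ENNReal.mul_rpow_of_nonneg _ _ (by positivity)]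
    refine ENNReal.rpow_le_rpow ?_ (by positivity)
    refine block_sum_le_tsum_weight hr hb _ _ _ fun k j hj => ?_
    refine sum_le_seqK hs hq x j _ fun ν hν => ?_
    have h1 := (mem_block_iff _ _).1 hν
    have h2 := (mem_block_iff _ _).1 hj
    omega
  · calc _ ≤ (D * ∑' k : ℕ, 2 ^ ((k : ℝ) * b * r) *
          (∑ ν ∈ Finset.Icc (2 ^ k - 1 : ℕ) (2 ^ (k + 1) - 2),
            ENNReal.ofReal (((2 : ℝ) ^ ((ν : ℝ) * s) * |x ν|) ^ q)) ^ (r / q)) ^ (1 / r) := by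
          refine ENNReal.rpow_le_rpow (hupper _ _ fun k j hj => ?_) (by positivity)
          refine (seqK_le hq x j).trans
            (mul_le_mul' le_rfl (ENNReal.rpow_le_rpow ?_ (by positivity)))
          rw [tsum_eq_tsum_sum_block]
          refine ENNReal.tsum_le_tsum fun i => ?_
          rw [Finset.mul_sum]
          refine Finset.sum_le_sum fun ν hν => ?_
          refine mul_le_mul' (two_rpow_mono ?_) le_rfl
          have := hL i k ν j hν hj
          linarith
      _ ≤ _ := by
          rw [ENNReal.mul_rpow_of_nonneg _ _ (by positivity)]
          refine mul_le_mul' ?_ le_rfl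
          rw [ENNReal.le_ofReal_iff_toReal_le hD' (by positivity)]
          linarith
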